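/- Let f : ℝ³ → [0,∞) be measurable, not almost everywhere zero, and satisfy ∫_{ℝ³} (1+|q|) f(q) dq < ∞. Then there exist a unique n > 0, a unique β > 0 and a unique u ∈ ℝ³ such that the Jüttner distribution J(q) = J(n,β,u;q) satisfies the five moment equalities ∫_{ℝ³} J(q) dq/q⁰ = ∫_{ℝ³} f(q) dq/q⁰, ∫_{ℝ³} J(q) dq = ∫_{ℝ³} f(q) dq, and ∫_{ℝ³} qⁱ J(q) dq/q⁰ = ∫_{ℝ³} qⁱ f(q) dq/q⁰ for i = 1,2,3. -/

import Mathlib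

open MeasureTheory Real
open scoped InnerProductSpace

noncomputable section

/-- Momentum space `ℝ³`. -/
abbrev E3 := EuclideanSpace ℝ (Fin 3)

/-- `q⁰ = √(1+|q|²)`. -/
def q0 (q : E3) : ℝ := Real.sqrt (1 + ‖q‖ ^ 2)

/-- Modified Bessel function `K_j(β) = ∫₀^∞ cosh(j r) exp(−β cosh r) dr`. -/
def Kb (j : ℕ) (β : ℝ) : ℝ :=
  ∫ r in Set.Ioi (0 : ℝ), Real.cosh (j * r) * Real.exp (-β * Real.cosh r)

end

noncomputable section

/-- `M(β) = ∫_{ℝ³} exp(−β √(1+|p|²)) dp`. -/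
def Mf (β : ℝ) : ℝ := ∫ p : E3, Real.exp (-β * Real.sqrt (1 + ‖p‖ ^ 2))

/-- `Ψ(β) = 3/β + K₁(β)/K₂(β)`. -/
def Ψf (β : ℝ) : ℝ := 3 / β + Kb 1 β / Kb 2 β

/-- The dimensionless Jüttner distribution
`J(n,β,u;q) = (n/M(β)) exp(−β(√(1+|u|²) q⁰ − u·q))`. -/
def Jut (n β : ℝ) (u : E3) (q : E3) : ℝ :=
  n / Mf β * Real.exp (-β * (Real.sqrt (1 + ‖u‖ ^ 2) * q0 q - ⟪u, q⟫_ℝ))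

end

section Juttner

open Filter Topology

lemma one_le_q0 (q : E3) : 1 ≤ q0 q :=
  Real.one_le_sqrt.2 (by nlinarith [sq_nonneg ‖q‖])

lemma q0_pos (q : E3) : 0 < q0 q := one_pos.trans_le (one_le_q0 q)

lemma q0_sq (q : E3) : q0 q ^ 2 = 1 + ‖q‖ ^ 2 := Real.sq_sqrt (by positivity)

lemma norm_le_q0 (q : E3) : ‖q‖ ≤ q0 q :=
  Real.le_sqrt_of_sq_le (by linarith)

lemma abs_inner_le_q0 (v q : E3) : |⟪v, q⟫_ℝ| ≤ ‖v‖ * q0 q :=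
  (abs_real_inner_le_norm v q).trans (mul_le_mul_of_nonneg_left (norm_le_q0 q) (norm_nonneg v))

lemma abs_inner_div_q0_le (v q : E3) : |⟪v, q⟫_ℝ / q0 q| ≤ ‖v‖ := by
  rw [abs_div, abs_of_pos (q0_pos q), div_le_iff₀ (q0_pos q)]
  exact abs_inner_le_q0 v q

@[fun_prop]
lemma continuous_q0 : Continuous q0 := by
  unfold q0
  fun_prop

lemma hasDerivAt_q0_line (q v : E3) :
    HasDerivAt (fun t : ℝ => q0 (q + t • v)) (⟪v, q⟫_ℝ / q0 q) 0 := by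
  have h1 : HasDerivAt (fun t : ℝ => q + t • v) v 0 := by
    simpa using ((hasDerivAt_id (0 : ℝ)).smul_const v).const_add q
  refine ((h1.norm_sq.const_add 1).sqrt (by positivity)).congr_deriv ?_
  simp only [zero_smul, add_zero, q0, real_inner_comm q v]
  ring

lemma hasDerivAt_inner_line (q v b : E3) :
    HasDerivAt (fun t : ℝ => ⟪b, q + t • v⟫_ℝ) ⟪b, v⟫_ℝ 0 := by
  have h : (fun t : ℝ => ⟪b, q + t • v⟫_ℝ) = fun t : ℝ => ⟪b, q⟫_ℝ + t * ⟪b, v⟫_ℝ := by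
    ext t
    rw [inner_add_right, real_inner_smul_right]
  rw [h]
  simpa using ((hasDerivAt_id (0 : ℝ)).mul_const ⟪b, v⟫_ℝ).const_add ⟪b, q⟫_ℝ

lemma integrable_exp_neg_mul_q0 {c : ℝ} (hc : 0 < c) :
    Integrable fun q : E3 => Real.exp (-(c * q0 q)) := by
  have hJ : Integrable fun q : E3 => (1 + ‖q‖) ^ (-(4 : ℝ)) :=
    integrable_one_add_norm (by simp; norm_num)
  refine (hJ.const_mul (384 / c ^ 4)).mono' (by fun_prop) (ae_of_all _ fun q => ?_)
  have h1 : (c * q0 q) ^ 4 / 24 ≤ Real.exp (c * q0 q) := by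
    have := Real.pow_div_factorial_le_exp _ (mul_pos hc (q0_pos q)).le 4
    norm_num [Nat.factorial] at this
    exact this
  have h2 : 1 + ‖q‖ ≤ 2 * q0 q := by linarith [one_le_q0 q, norm_le_q0 q]
  have h3 : (1 + ‖q‖) ^ 4 ≤ (2 * q0 q) ^ 4 := by gcongr
  have h4 : (1 + ‖q‖) ^ (-(4 : ℝ)) = ((1 + ‖q‖) ^ 4)⁻¹ := by
    rw [Real.rpow_neg (by positivity)]
    norm_cast
  rw [Real.norm_eq_abs, abs_of_pos (Real.exp_pos _), Real.exp_neg, h4, ← div_eq_mul_inv,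
    le_div_iff₀ (by positivity), inv_mul_le_iff₀ (Real.exp_pos _), mul_div_assoc',
    le_div_iff₀ (by positivity)]
  have h5 := mul_le_mul_of_nonneg_right h3 (pow_pos hc 4).le
  nlinarith [h1, h5]

/-- The unnormalised Jüttner weight with natural parameters `(a, b)`. -/
noncomputable def boltz (a : ℝ) (b q : E3) : ℝ := Real.exp (-(a * q0 q - ⟪b, q⟫_ℝ))

lemma boltz_pos (a : ℝ) (b q : E3) : 0 < boltz a b q := Real.exp_pos _

@[fun_prop]
lemma continuous_boltz (a : ℝ) (b : E3) : Continuous (boltz a b) := by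
  unfold boltz
  fun_prop

lemma boltz_le {a c : ℝ} {b : E3} (h : c ≤ a - ‖b‖) (q : E3) :
    boltz a b q ≤ Real.exp (-(c * q0 q)) := by
  refine Real.exp_le_exp.2 (neg_le_neg ?_)
  have h1 := le_of_abs_le (abs_inner_le_q0 b q)
  have h2 := mul_le_mul_of_nonneg_right h (q0_pos q).le
  linarith

lemma integrable_mul_boltz {g : E3 → ℝ} (hg : Continuous g) {C : ℝ} (hC : ∀ q, |g q| ≤ C)
    {a : ℝ} {b : E3} (hab : ‖b‖ < a) : Integrable fun q => g q * boltz a b q := by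
  refine ((integrable_exp_neg_mul_q0 (sub_pos.2 hab)).const_mul C).mono' (by fun_prop)
    (ae_of_all _ fun q => ?_)
  rw [Real.norm_eq_abs, abs_mul, abs_of_pos (boltz_pos a b q)]
  exact mul_le_mul (hC q) (boltz_le le_rfl q) (boltz_pos a b q).le ((abs_nonneg _).trans (hC q))

lemma integrable_boltz {a : ℝ} {b : E3} (hab : ‖b‖ < a) : Integrable (boltz a b) := by
  simpa using integrable_mul_boltz (g := fun _ => 1) continuous_const (C := 1) (by simp) hab

@[fun_prop]
lemma continuous_inv_q0 : Continuous fun q => (q0 q)⁻¹ :=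
  continuous_q0.inv₀ fun q => (q0_pos q).ne'

lemma abs_inv_q0_le (q : E3) : |(q0 q)⁻¹| ≤ 1 := by
  rw [abs_of_pos (inv_pos.2 (q0_pos q))]
  exact inv_le_one_of_one_le₀ (one_le_q0 q)

@[fun_prop]
lemma continuous_inner_div_q0 (v : E3) : Continuous fun q => ⟪v, q⟫_ℝ / q0 q :=
  Continuous.div (by fun_prop) (by fun_prop) fun q => (q0_pos q).ne'

lemma integrable_boltz_div_q0 {a : ℝ} {b : E3} (hab : ‖b‖ < a) :
    Integrable fun q => boltz a b q / q0 q := by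
  refine (integrable_mul_boltz continuous_inv_q0 abs_inv_q0_le hab).congr (ae_of_all _ fun q => ?_)
  simp only
  ring

lemma integrable_inner_div_q0_mul_boltz (v : E3) {a : ℝ} {b : E3} (hab : ‖b‖ < a) :
    Integrable fun q => ⟪v, q⟫_ℝ / q0 q * boltz a b q :=
  integrable_mul_boltz (continuous_inner_div_q0 v) (abs_inner_div_q0_le v) hab

lemma hasDerivAt_boltz_line (a : ℝ) (b q v : E3) :
    HasDerivAt (fun t : ℝ => boltz a b (q + t • v))
      (-(a * (⟪v, q⟫_ℝ / q0 q) - ⟪v, b⟫_ℝ) * boltz a b q) 0 := by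
  refine (((hasDerivAt_q0_line q v).const_mul a).sub
    (hasDerivAt_inner_line q v b)).neg.exp.congr_deriv ?_
  simp only [Pi.neg_apply, Pi.sub_apply, zero_smul, add_zero, boltz, real_inner_comm v b]
  ring

lemma integral_hasLineDerivAt_eq_zero {g g' : E3 → ℝ} {v : E3} (hg : Integrable g)
    (hg' : Integrable g') (h : ∀ q, HasLineDerivAt ℝ g (g' q) q v) : ∫ q, g' q = 0 := by
  have := integral_bilinear_hasLineDerivAt_right_eq_neg_left_of_integrable
    (μ := (volume : Measure E3)) (f := fun _ => (1 : ℝ)) (f' := fun _ => 0) (g := g) (g' := g')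
    (v := v) (B := ContinuousLinearMap.mul ℝ ℝ) (by simp) (by simpa using hg') (by simpa using hg)
    (fun q _ => by simpa [HasLineDerivAt] using hasDerivAt_const (0 : ℝ) (1 : ℝ))
    (fun q _ => h q)
  simpa using this

lemma integral_inner_div_q0_mul_boltz (v : E3) {a : ℝ} {b : E3} (hab : ‖b‖ < a) :
    a * ∫ q, ⟪v, q⟫_ℝ / q0 q * boltz a b q = ⟪v, b⟫_ℝ * ∫ q, boltz a b q := by
  have i1 := (integrable_inner_div_q0_mul_boltz v hab).const_mul a
  have i2 := (integrable_boltz hab).const_mul ⟪v, b⟫_ℝ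
  have h0 := integral_hasLineDerivAt_eq_zero (integrable_boltz hab) (i2.sub i1)
    (v := v) (fun q => by
      refine (hasDerivAt_boltz_line a b q v).congr_deriv ?_
      simp only [Pi.sub_apply]
      ring)
  simp only [Pi.sub_apply] at h0
  rw [integral_sub i2 i1, integral_const_mul, integral_const_mul] at h0
  linarith

/-- Differentiation under the integral along a curve of natural parameters. -/
lemma hasDerivAt_integral_boltz_div_q0 {a a' : ℝ → ℝ} {b b' : ℝ → E3} {t₀ : ℝ}
    (ha : ∀ t, HasDerivAt a (a' t) t) (hb : ∀ t, HasDerivAt b (b' t) t)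
    (ha' : Continuous a') (hb' : Continuous b') (h : ‖b t₀‖ < a t₀) :
    HasDerivAt (fun t => ∫ q, boltz (a t) (b t) q / q0 q)
      (-(a' t₀ * (∫ q, boltz (a t₀) (b t₀) q) -
        ∫ q, ⟪b' t₀, q⟫_ℝ / q0 q * boltz (a t₀) (b t₀) q)) t₀ := by
  set c := a t₀ - ‖b t₀‖ with hc
  have hcpos : 0 < c := sub_pos.2 h
  have hac : Continuous a := continuous_iff_continuousAt.2 fun t => (ha t).continuousAt
  have hbc : Continuous b := continuous_iff_continuousAt.2 fun t => (hb t).continuousAt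
  have e1 : ∀ᶠ t in 𝓝 t₀, c / 2 < a t - ‖b t‖ :=
    (hac.sub hbc.norm).continuousAt.eventually_const_lt (by simpa [← hc] using hcpos)
  have e2 : ∀ᶠ t in 𝓝 t₀, |a' t| + ‖b' t‖ < |a' t₀| + ‖b' t₀‖ + 1 :=
    (ha'.abs.add hb'.norm).continuousAt.eventually_lt_const (by simp)
  have key := hasDerivAt_integral_of_dominated_loc_of_deriv_le (μ := (volume : Measure E3))
    (F := fun t q => boltz (a t) (b t) q / q0 q)
    (F' := fun t q => -(a' t - ⟪b' t, q⟫_ℝ / q0 q) * boltz (a t) (b t) q)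
    (bound := fun q => (|a' t₀| + ‖b' t₀‖ + 1) * Real.exp (-(c / 2 * q0 q)))
    (e1.and e2)
    (Eventually.of_forall fun t => (Continuous.div (by fun_prop) (by fun_prop)
      fun q => (q0_pos q).ne').aestronglyMeasurable)
    (integrable_boltz_div_q0 h)
    (by fun_prop)
    (ae_of_all _ fun q t ht => by
      rw [Real.norm_eq_abs, abs_mul, abs_neg, abs_of_pos (boltz_pos _ _ _)]
      refine mul_le_mul ?_ (boltz_le ht.1.le q) (boltz_pos _ _ _).le (by positivity)
      have := abs_sub (a' t) (⟪b' t, q⟫_ℝ / q0 q)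
      linarith [abs_inner_div_q0_le (b' t) q, ht.2])
    ((integrable_exp_neg_mul_q0 (half_pos hcpos)).const_mul _)
    (ae_of_all _ fun q t _ => by
      have hi : HasDerivAt (fun t => ⟪b t, q⟫_ℝ) ⟪b' t, q⟫_ℝ t := by
        simpa using (hb t).inner ℝ (hasDerivAt_const t q)
      refine ((((ha t).mul_const (q0 q)).sub hi).neg.exp.div_const (q0 q)).congr_deriv ?_
      have := (q0_pos q).ne'
      simp only [boltz, Pi.neg_apply, Pi.sub_apply]
      field_simp)
  refine key.2.congr_deriv ?_
  rw [← integral_const_mul, ← integral_sub ((integrable_boltz h).const_mul _)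
    (integrable_inner_div_q0_mul_boltz _ h), ← integral_neg]
  congr 1 with q
  ring

lemma norm_smul_lt_mul_sqrt {β : ℝ} (hβ : 0 < β) (u : E3) : ‖β • u‖ < β * √(1 + ‖u‖ ^ 2) := by
  rw [norm_smul, Real.norm_eq_abs, abs_of_pos hβ]
  exact mul_lt_mul_of_pos_left (Real.lt_sqrt_of_sq_lt (by linarith)) hβ

lemma norm_mul_sinh_smul_lt {β : ℝ} (hβ : 0 < β) {e : E3} (he : ‖e‖ = 1) (s : ℝ) :
    ‖(β * Real.sinh s) • e‖ < β * Real.cosh s := by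
  rw [norm_smul, he, mul_one, Real.norm_eq_abs, abs_mul, abs_of_pos hβ]
  refine mul_lt_mul_of_pos_left (abs_lt_of_sq_lt_sq ?_ (Real.cosh_pos s).le) hβ
  nlinarith [Real.cosh_sq s]

/-- The mass-shell integral is invariant under Lorentz boosts. -/
lemma integral_boltz_div_q0_boost {β : ℝ} (hβ : 0 < β) {e : E3} (he : ‖e‖ = 1) (s : ℝ) :
    ∫ q, boltz (β * Real.cosh s) ((β * Real.sinh s) • e) q / q0 q = ∫ q, boltz β 0 q / q0 q := by
  have hd : ∀ s : ℝ, HasDerivAt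
      (fun s => ∫ q, boltz (β * Real.cosh s) ((β * Real.sinh s) • e) q / q0 q) 0 s := fun s => by
    have hlt := norm_mul_sinh_smul_lt hβ he s
    refine (hasDerivAt_integral_boltz_div_q0 (a := fun s => β * Real.cosh s)
      (b := fun s => (β * Real.sinh s) • e) (a' := fun s => β * Real.sinh s)
      (b' := fun s => (β * Real.cosh s) • e) (t₀ := s)
      (fun t => (Real.hasDerivAt_cosh t).const_mul β)
      (fun t => ((Real.hasDerivAt_sinh t).const_mul β).smul_const e)
      (by fun_prop) (by fun_prop) hlt).congr_deriv ?_
    have h := integral_inner_div_q0_mul_boltz e hlt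
    rw [real_inner_smul_right, real_inner_self_eq_norm_sq, he] at h
    simp only [real_inner_smul_left, mul_div_assoc, mul_assoc (β * Real.cosh s),
      integral_const_mul]
    linarith
  have := is_const_of_deriv_eq_zero (fun s => (hd s).differentiableAt) (fun s => (hd s).deriv) s 0
  simpa using this

lemma integral_boltz_div_q0_eq {β : ℝ} (hβ : 0 < β) (u : E3) :
    ∫ q, boltz (β * √(1 + ‖u‖ ^ 2)) (β • u) q / q0 q = ∫ q, boltz β 0 q / q0 q := by
  rcases eq_or_ne u 0 with rfl | hu
  · simp
  have hn : ‖u‖ ≠ 0 := norm_ne_zero_iff.2 hu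
  have h := integral_boltz_div_q0_boost hβ (e := ‖u‖⁻¹ • u) (by simp [norm_smul, hn])
    (Real.arsinh ‖u‖)
  rwa [Real.cosh_arsinh, Real.sinh_arsinh, smul_smul, mul_assoc, mul_inv_cancel₀ hn, mul_one] at h

lemma hasDerivAt_integral_boltz_mul {β : ℝ} (hβ : 0 < β) (u : E3) :
    HasDerivAt (fun β => ∫ q, boltz (β * √(1 + ‖u‖ ^ 2)) (β • u) q / q0 q)
      (-((∫ q, boltz (β * √(1 + ‖u‖ ^ 2)) (β • u) q) / √(1 + ‖u‖ ^ 2))) β := by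
  have hlt := norm_smul_lt_mul_sqrt hβ u
  have hu0 : 0 < √(1 + ‖u‖ ^ 2) := by positivity
  have hu2 : √(1 + ‖u‖ ^ 2) ^ 2 = 1 + ‖u‖ ^ 2 := Real.sq_sqrt (by positivity)
  refine (hasDerivAt_integral_boltz_div_q0 (a := fun β => β * √(1 + ‖u‖ ^ 2))
    (b := fun β => β • u) (a' := fun _ => √(1 + ‖u‖ ^ 2)) (b' := fun _ => u) (t₀ := β)
    (fun t => by simpa using (hasDerivAt_id t).mul_const (√(1 + ‖u‖ ^ 2)))
    (fun t => by simpa using (hasDerivAt_id t).smul_const u)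
    (by fun_prop) (by fun_prop) hlt).congr_deriv ?_
  have h := integral_inner_div_q0_mul_boltz u hlt
  rw [real_inner_smul_right, real_inner_self_eq_norm_sq] at h
  set I := ∫ q, ⟪u, q⟫_ℝ / q0 q * boltz (β * √(1 + ‖u‖ ^ 2)) (β • u) q
  set N := ∫ q, boltz (β * √(1 + ‖u‖ ^ 2)) (β • u) q
  have h' : √(1 + ‖u‖ ^ 2) * I = ‖u‖ ^ 2 * N :=
    mul_left_cancel₀ hβ.ne' (by linarith)
  rw [neg_inj, eq_div_iff hu0.ne']
  linear_combination N * hu2 - h'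

lemma integral_boltz_eq {β : ℝ} (hβ : 0 < β) (u : E3) :
    ∫ q, boltz (β * √(1 + ‖u‖ ^ 2)) (β • u) q = √(1 + ‖u‖ ^ 2) * ∫ q, boltz β 0 q := by
  have hu0 : 0 < √(1 + ‖u‖ ^ 2) := by positivity
  have h1 := hasDerivAt_integral_boltz_mul hβ u
  have h2 := hasDerivAt_integral_boltz_mul hβ 0
  have h3 := h2.congr_of_eventuallyEq
      (f₁ := fun β => ∫ q, boltz (β * √(1 + ‖u‖ ^ 2)) (β • u) q / q0 q) <| by
    filter_upwards [eventually_gt_nhds hβ] with t ht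
    rw [integral_boltz_div_q0_eq ht, integral_boltz_div_q0_eq ht]
  have h4 := h1.unique h3
  simp only [norm_zero, ne_eq, OfNat.ofNat_ne_zero, not_false_eq_true, zero_pow, add_zero,
    Real.sqrt_one, mul_one, smul_zero, div_one, neg_inj] at h4
  rw [div_eq_iff hu0.ne'] at h4
  rw [h4, mul_comm]

lemma Mf_eq (β : ℝ) : Mf β = ∫ q, boltz β 0 q := by
  simp [Mf, boltz, q0]

lemma Mf_pos {β : ℝ} (hβ : 0 < β) : 0 < Mf β := by
  rw [Mf_eq]
  exact integral_exp_pos (integrable_boltz (by simpa using hβ))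

/-- The ratio `K₁(β) / K₂(β)`, expressed through integrals over momentum space. -/
noncomputable def massRatio (β : ℝ) : ℝ := (∫ q, boltz β 0 q / q0 q) / Mf β

lemma Jut_eq (n β : ℝ) (u q : E3) :
    Jut n β u q = n / Mf β * boltz (β * √(1 + ‖u‖ ^ 2)) (β • u) q := by
  rw [Jut, boltz, real_inner_smul_left]
  ring_nf

lemma integral_Jut (n : ℝ) {β : ℝ} (hβ : 0 < β) (u : E3) :
    ∫ q, Jut n β u q = n * √(1 + ‖u‖ ^ 2) := by
  simp only [Jut_eq, integral_const_mul]
  rw [integral_boltz_eq hβ, ← Mf_eq]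
  have := (Mf_pos hβ).ne'
  field_simp

lemma integral_Jut_div_q0 (n : ℝ) {β : ℝ} (hβ : 0 < β) (u : E3) :
    ∫ q, Jut n β u q / q0 q = n * massRatio β := by
  simp only [Jut_eq, mul_div_assoc, integral_const_mul]
  rw [integral_boltz_div_q0_eq hβ, massRatio]
  ring

lemma integral_apply_mul_Jut_div_q0 (n : ℝ) {β : ℝ} (hβ : 0 < β) (u : E3) (i : Fin 3) :
    ∫ q : E3, q i * Jut n β u q / q0 q = n * u i := by
  have h := integral_inner_div_q0_mul_boltz (EuclideanSpace.single i 1) (norm_smul_lt_mul_sqrt hβ u)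
  rw [integral_boltz_eq hβ, ← Mf_eq] at h
  simp only [EuclideanSpace.inner_single_left, map_one, one_mul, PiLp.smul_apply,
    smul_eq_mul] at h
  have hM := (Mf_pos hβ).ne'
  have hu0 : √(1 + ‖u‖ ^ 2) ≠ 0 := by positivity
  have e : (fun q : E3 => q i * Jut n β u q / q0 q) = fun q : E3 =>
      n / Mf β * (q i / q0 q * boltz (β * √(1 + ‖u‖ ^ 2)) (β • u) q) := by
    ext q
    rw [Jut_eq]
    ring
  rw [e, integral_const_mul, div_mul_eq_mul_div, div_eq_iff hM]
  have h' := mul_left_cancel₀ (mul_ne_zero hβ.ne' hu0)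
    (h.trans (by ring : _ = β * √(1 + ‖u‖ ^ 2) * (u i * Mf β)))
  rw [h']
  ring

lemma inv_q0_pow_pos (k : ℕ) (q : E3) : 0 < (q0 q ^ k)⁻¹ := inv_pos.2 (pow_pos (q0_pos q) k)

lemma integrable_inv_q0_pow_mul_boltz (k : ℕ) {β : ℝ} (hβ : 0 < β) :
    Integrable fun q => (q0 q ^ k)⁻¹ * boltz β 0 q := by
  refine integrable_mul_boltz (C := 1) ?_ (fun q => ?_) (by simpa using hβ)
  · simp_rw [← inv_pow]
    fun_prop
  · rw [abs_of_pos (inv_q0_pow_pos k q)]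
    exact inv_le_one_of_one_le₀ (one_le_pow₀ (one_le_q0 q))

lemma integral_inv_q0_pow_mul_boltz_nonneg (k : ℕ) (β : ℝ) :
    0 ≤ ∫ q, (q0 q ^ k)⁻¹ * boltz β 0 q :=
  integral_nonneg fun q => (mul_pos (inv_q0_pow_pos k q) (boltz_pos β 0 q)).le

lemma integral_inv_q0_pow_mul_boltz_anti {j k : ℕ} (hjk : j ≤ k) {β : ℝ} (hβ : 0 < β) :
    ∫ q, (q0 q ^ k)⁻¹ * boltz β 0 q ≤ ∫ q, (q0 q ^ j)⁻¹ * boltz β 0 q :=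
  integral_mono (integrable_inv_q0_pow_mul_boltz k hβ) (integrable_inv_q0_pow_mul_boltz j hβ)
    fun q => mul_le_mul_of_nonneg_right (inv_anti₀ (pow_pos (q0_pos q) j)
      (pow_le_pow_right₀ (one_le_q0 q) hjk)) (boltz_pos β 0 q).le

/-- The virial identity obtained by integrating the divergence of `(q / q⁰) exp (-β q⁰)`. -/
lemma integral_boltz_virial {β : ℝ} (hβ : 0 < β) :
    β * ((∫ q, (q0 q ^ 0)⁻¹ * boltz β 0 q) - ∫ q, (q0 q ^ 2)⁻¹ * boltz β 0 q) =
      2 * (∫ q, (q0 q ^ 1)⁻¹ * boltz β 0 q) + ∫ q, (q0 q ^ 3)⁻¹ * boltz β 0 q := by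
  have hlt : ‖(0 : E3)‖ < β := by simpa using hβ
  have hq : ∀ q, q0 q ≠ 0 := fun q => (q0_pos q).ne'
  have hb (v : E3) (hv : ‖v‖ = 1) (q : E3) : |⟪v, q⟫_ℝ / q0 q| ≤ 1 :=
    hv ▸ abs_inner_div_q0_le v q
  have hb2 (v : E3) (hv : ‖v‖ = 1) (q : E3) : |(⟪v, q⟫_ℝ / q0 q) ^ 2| ≤ 1 := by
    rw [abs_pow]
    exact pow_le_one₀ (abs_nonneg _) (hb v hv q)
  have hw (v : E3) (hv : ‖v‖ = 1) (q : E3) :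
      |(q0 q)⁻¹ * (1 - (⟪v, q⟫_ℝ / q0 q) ^ 2) - β * (⟪v, q⟫_ℝ / q0 q) ^ 2| ≤ 1 + β := by
    have h1 := abs_le.1 (hb2 v hv q)
    have h2 := abs_le.1 (abs_inv_q0_le q)
    have h3 := inv_pos.2 (q0_pos q)
    have h4 := sq_nonneg (⟪v, q⟫_ℝ / q0 q)
    have h5 : (q0 q)⁻¹ * (1 - (⟪v, q⟫_ℝ / q0 q) ^ 2) ≤ 1 * 1 :=
      mul_le_mul h2.2 (by linarith) (by linarith [h1.2]) zero_le_one
    have h6 : 0 ≤ (q0 q)⁻¹ * (1 - (⟪v, q⟫_ℝ / q0 q) ^ 2) := mul_nonneg h3.le (by linarith [h1.2])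
    rw [abs_le]
    constructor <;> nlinarith [h1.2]
  have hint (v : E3) (hv : ‖v‖ = 1) : Integrable fun q =>
      ((q0 q)⁻¹ * (1 - (⟪v, q⟫_ℝ / q0 q) ^ 2) - β * (⟪v, q⟫_ℝ / q0 q) ^ 2) * boltz β 0 q :=
    integrable_mul_boltz (by fun_prop) (hw v hv) hlt
  have hzero (v : E3) (hv : ‖v‖ = 1) : ∫ q,
      ((q0 q)⁻¹ * (1 - (⟪v, q⟫_ℝ / q0 q) ^ 2) - β * (⟪v, q⟫_ℝ / q0 q) ^ 2) * boltz β 0 q = 0 := by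
    refine integral_hasLineDerivAt_eq_zero (v := v)
      (integrable_inner_div_q0_mul_boltz v hlt) (hint v hv) fun q => ?_
    refine (((hasDerivAt_inner_line q v v).div (hasDerivAt_q0_line q v)
      (by simpa using hq q)).mul (hasDerivAt_boltz_line β 0 q v)).congr_deriv ?_
    simp only [real_inner_self_eq_norm_sq, hv, zero_smul, add_zero, inner_zero_right, Pi.div_apply]
    have := hq q
    field_simp
    ring
  have hsum : ∫ q, ∑ i : Fin 3,
      ((q0 q)⁻¹ * (1 - (⟪EuclideanSpace.single i (1 : ℝ), q⟫_ℝ / q0 q) ^ 2) -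
        β * (⟪EuclideanSpace.single i (1 : ℝ), q⟫_ℝ / q0 q) ^ 2) * boltz β 0 q = 0 := by
    rw [integral_finsetSum _ fun i _ => hint _ (by simp)]
    exact Finset.sum_eq_zero fun i _ => hzero _ (by simp)
  have J := fun k => integrable_inv_q0_pow_mul_boltz k hβ
  have JL : Integrable fun q => β * ((q0 q ^ 0)⁻¹ * boltz β 0 q - (q0 q ^ 2)⁻¹ * boltz β 0 q) :=
    ((J 0).sub (J 2)).const_mul β
  have JR : Integrable fun q => 2 * ((q0 q ^ 1)⁻¹ * boltz β 0 q) + (q0 q ^ 3)⁻¹ * boltz β 0 q :=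
    ((J 1).const_mul 2).add (J 3)
  rw [← sub_eq_zero, ← integral_sub (J 0) (J 2), ← integral_const_mul, ← integral_const_mul,
    ← integral_add ((J 1).const_mul 2) (J 3), ← integral_sub JL JR, ← neg_eq_zero,
    ← integral_neg, ← hsum]
  congr 1 with q
  have hn : ∑ i : Fin 3, q i ^ 2 = q0 q ^ 2 - 1 := by
    rw [q0_sq, EuclideanSpace.norm_sq_eq]
    simp
  simp only [EuclideanSpace.inner_single_left, map_one, one_mul]
  rw [Fin.sum_univ_three] at hn ⊢
  have := hq q
  field_simp
  have h0 : q 0 ^ 2 = q0 q ^ 2 - 1 - q 1 ^ 2 - q 2 ^ 2 := by linarith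
  rw [h0]
  ring

lemma Mf_eq_pow (β : ℝ) : Mf β = ∫ q, (q0 q ^ 0)⁻¹ * boltz β 0 q := by
  simp [Mf_eq]

lemma massRatio_eq_pow (β : ℝ) : massRatio β = (∫ q, (q0 q ^ 1)⁻¹ * boltz β 0 q) / Mf β := by
  simp only [massRatio, pow_one, div_eq_inv_mul]

lemma massRatio_le {β : ℝ} (hβ : 0 < β) : massRatio β ≤ β / 2 := by
  rw [massRatio_eq_pow, div_le_iff₀ (Mf_pos hβ), Mf_eq_pow]
  have := mul_nonneg hβ.le (integral_inv_q0_pow_mul_boltz_nonneg 2 β)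
  linarith [integral_boltz_virial hβ, integral_inv_q0_pow_mul_boltz_nonneg 3 β]

lemma le_massRatio {β : ℝ} (hβ : 0 < β) : 1 - 3 / β ≤ massRatio β := by
  rw [massRatio_eq_pow, le_div_iff₀ (Mf_pos hβ), Mf_eq_pow]
  have h1 := integral_inv_q0_pow_mul_boltz_anti (show 1 ≤ 2 by simp) hβ
  have h2 := integral_inv_q0_pow_mul_boltz_anti (show 1 ≤ 3 by simp) hβ
  have h3 := integral_inv_q0_pow_mul_boltz_anti (show 0 ≤ 1 by simp) hβ
  have h4 := integral_boltz_virial hβ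
  have h5 := mul_le_mul_of_nonneg_left h1 hβ.le
  refine le_of_mul_le_mul_left ?_ hβ
  rw [← mul_assoc, mul_sub, mul_one, mul_div_cancel₀ _ hβ.ne']
  linarith

lemma continuousAt_Mf {β : ℝ} (hβ : 0 < β) : ContinuousAt Mf β := by
  have h : ContinuousAt (fun β => ∫ q, boltz β 0 q) β := by
    refine continuousAt_of_dominated (bound := fun q => Real.exp (-(β / 2 * q0 q)))
      (Eventually.of_forall fun t => (continuous_boltz t 0).aestronglyMeasurable) ?_
      (integrable_exp_neg_mul_q0 (half_pos hβ)) (ae_of_all _ fun q => ?_)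
    · filter_upwards [eventually_gt_nhds (half_lt_self hβ)] with t ht
      refine ae_of_all _ fun q => ?_
      rw [Real.norm_eq_abs, abs_of_pos (boltz_pos _ _ _)]
      exact boltz_le (by simpa using ht.le) q
    · unfold boltz
      fun_prop
  simpa only [← Mf_eq] using h

lemma continuousOn_massRatio : ContinuousOn massRatio (Set.Ioi 0) := fun β hβ => by
  have h := (hasDerivAt_integral_boltz_mul hβ 0).continuousAt
  simp only [norm_zero, ne_eq, OfNat.ofNat_ne_zero, not_false_eq_true, zero_pow, add_zero,
    Real.sqrt_one, mul_one, smul_zero] at h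
  exact (h.div (continuousAt_Mf hβ) (Mf_pos hβ).ne').continuousWithinAt

lemma exists_massRatio_eq {r : ℝ} (h0 : 0 < r) (h1 : r < 1) : ∃ β, 0 < β ∧ massRatio β = r := by
  have h1' : 0 < 1 - r := sub_pos.2 h1
  have hlow : massRatio (2 * r) ≤ r := (massRatio_le (by positivity)).trans (by linarith)
  have hup : r ≤ massRatio (3 / (1 - r)) := by
    refine le_trans (le_of_eq ?_) (le_massRatio (by positivity))
    field_simp
    ring
  obtain ⟨β, hβ, h⟩ := isPreconnected_Ioi.intermediate_value (show 2 * r ∈ Set.Ioi 0 by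
    simpa using h0) (show 3 / (1 - r) ∈ Set.Ioi 0 by simp [h1]) continuousOn_massRatio ⟨hlow, hup⟩
  exact ⟨β, hβ, h⟩

lemma exp_sub_mul_sub_nonneg (x y : ℝ) : 0 ≤ (Real.exp x - Real.exp y) * (x - y) := by
  rcases le_total x y with h | h
  · exact mul_nonneg_of_nonpos_of_nonpos (sub_nonpos.2 (Real.exp_le_exp.2 h)) (sub_nonpos.2 h)
  · exact mul_nonneg (sub_nonneg.2 (Real.exp_le_exp.2 h)) (sub_nonneg.2 h)

lemma massRatio_injOn : Set.InjOn massRatio (Set.Ioi 0) := by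
  intro β₁ h₁ β₂ h₂ h
  rw [Set.mem_Ioi] at h₁ h₂
  set c := Real.log (Mf β₂) - Real.log (Mf β₁) with hc
  set d := β₂ - β₁ with hd
  set φ : ℝ → E3 → ℝ := fun β q => (Mf β)⁻¹ * boltz β 0 q with hφ
  have hφexp {β : ℝ} (hβ : 0 < β) (q : E3) :
      φ β q = Real.exp (-Real.log (Mf β) - β * q0 q) := by
    rw [sub_eq_add_neg, Real.exp_add, Real.exp_neg, Real.exp_log (Mf_pos hβ)]
    simp [hφ, boltz]
  have hlog (q : E3) : (-Real.log (Mf β₁) - β₁ * q0 q) - (-Real.log (Mf β₂) - β₂ * q0 q) =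
      c + d * q0 q := by
    rw [hc, hd]
    ring
  have I {β : ℝ} (hβ : 0 < β) : Integrable (φ β) :=
    (integrable_boltz (by simpa using hβ)).const_mul _
  have I' {β : ℝ} (hβ : 0 < β) : Integrable (fun q => φ β q / q0 q) := by
    simp only [hφ, mul_div_assoc]
    exact (integrable_boltz_div_q0 (by simpa using hβ)).const_mul _
  have S {β : ℝ} (hβ : 0 < β) : ∫ q, φ β q = 1 := by
    rw [integral_const_mul, ← Mf_eq, inv_mul_cancel₀ (Mf_pos hβ).ne']
  have S' (β : ℝ) : ∫ q, φ β q / q0 q = massRatio β := by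
    simp only [hφ, mul_div_assoc]
    rw [integral_const_mul, massRatio, div_eq_inv_mul]
  set g : E3 → ℝ := fun q => c * (φ β₁ q / q0 q - φ β₂ q / q0 q) + d * (φ β₁ q - φ β₂ q) with hg
  have hg' (q : E3) : g q = (φ β₁ q - φ β₂ q) * (c + d * q0 q) * (q0 q)⁻¹ := by
    have := (q0_pos q).ne'
    simp only [hg]
    field_simp
  have hg0 : 0 ≤ g := fun q => by
    rw [Pi.zero_apply, hg', hφexp h₁, hφexp h₂, ← hlog]
    exact mul_nonneg (exp_sub_mul_sub_nonneg _ _) (inv_pos.2 (q0_pos q)).le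
  have i1 := ((I' h₁).sub (I' h₂)).const_mul c
  have i2 := ((I h₁).sub (I h₂)).const_mul d
  have hgint : Integrable g := i1.add i2
  have hgzero : ∫ q, g q = 0 := by
    refine (integral_add i1 i2).trans ?_
    rw [integral_const_mul, integral_const_mul]
    simp only [Pi.sub_apply]
    rw [integral_sub (I' h₁) (I' h₂), integral_sub (I h₁) (I h₂), S h₁, S h₂, S', S', h]
    ring
  have hgcont : Continuous g := by
    have : g = fun q => (φ β₁ q - φ β₂ q) * (c + d * q0 q) * (q0 q)⁻¹ := funext hg'
    rw [this]
    simp only [hφ]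
    fun_prop
  have hgeq : g = 0 := hgcont.ae_eq_iff_eq volume continuous_zero |>.1
    ((integral_eq_zero_iff_of_nonneg hg0 hgint).1 hgzero)
  have hlin (q : E3) : c + d * q0 q = 0 := by
    have h0 : g q = 0 := congrFun hgeq q
    rw [hg'] at h0
    rcases mul_eq_zero.1 h0 with h0 | h0
    · rcases mul_eq_zero.1 h0 with h0 | h0
      · rw [hφexp h₁, hφexp h₂, sub_eq_zero] at h0
        rw [← hlog, Real.exp_injective h0, sub_self]
      · exact h0
    · exact absurd h0 (inv_pos.2 (q0_pos q)).ne'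
  have e0 := hlin 0
  have e1 := hlin (EuclideanSpace.single 0 (√3))
  have q00 : q0 0 = 1 := by simp [q0]
  have q01 : q0 (EuclideanSpace.single 0 (√3)) = 2 := by
    rw [q0, Real.sqrt_eq_iff_mul_self_eq_of_pos two_pos]
    norm_num
  rw [q00] at e0
  rw [q01] at e1
  linarith

lemma add_inner_sq_add_norm_sq_le (A : ℝ) (B q : E3) :
    (A + ⟪B, q⟫_ℝ) ^ 2 + ‖A • q - B‖ ^ 2 ≤ (A ^ 2 + ‖B‖ ^ 2) * (1 + ‖q‖ ^ 2) := by
  have h1 : ‖A • q - B‖ ^ 2 = A ^ 2 * ‖q‖ ^ 2 - 2 * (A * ⟪B, q⟫_ℝ) + ‖B‖ ^ 2 := by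
    rw [norm_sub_sq_real, norm_smul, real_inner_smul_left, real_inner_comm, mul_pow,
      Real.norm_eq_abs, sq_abs]
  have h2 : ⟪B, q⟫_ℝ ^ 2 ≤ (‖B‖ * ‖q‖) ^ 2 := sq_le_sq' (neg_le_of_abs_le
    (abs_real_inner_le_norm B q)) (le_of_abs_le (abs_real_inner_le_norm B q))
  linarith

lemma add_inner_le (A : ℝ) (B q : E3) :
    A + ⟪B, q⟫_ℝ ≤ √(A ^ 2 + ‖B‖ ^ 2) * q0 q := by
  rw [q0, ← Real.sqrt_mul (by positivity)]
  refine Real.le_sqrt_of_sq_le ?_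
  linarith [add_inner_sq_add_norm_sq_le A B q, sq_nonneg ‖A • q - B‖]

lemma smul_eq_of_add_inner_eq {A : ℝ} {B q : E3}
    (h : A + ⟪B, q⟫_ℝ = √(A ^ 2 + ‖B‖ ^ 2) * q0 q) : A • q = B := by
  have h1 : (A + ⟪B, q⟫_ℝ) ^ 2 = (A ^ 2 + ‖B‖ ^ 2) * (1 + ‖q‖ ^ 2) := by
    rw [h, mul_pow, q0_sq, Real.sq_sqrt (by positivity)]
  have h2 : ‖A • q - B‖ ^ 2 = 0 := le_antisymm
    (by linarith [add_inner_sq_add_norm_sq_le A B q]) (sq_nonneg _)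
  exact sub_eq_zero.1 (norm_eq_zero.1 (pow_eq_zero_iff two_ne_zero |>.1 h2))

lemma integrable_div_q0 {f : E3 → ℝ} (hf : Integrable f) : Integrable fun q => f q / q0 q := by
  refine hf.norm.mono' (hf.1.mul continuous_inv_q0.aestronglyMeasurable) (ae_of_all _ fun q => ?_)
  rw [norm_div, Real.norm_eq_abs (q0 q), abs_of_pos (q0_pos q)]
  exact div_le_self (norm_nonneg _) (one_le_q0 q)

lemma integrable_div_q0_smul {f : E3 → ℝ} (hf : Integrable f) :
    Integrable fun q => (f q / q0 q) • q := by
  refine hf.norm.mono' ((integrable_div_q0 hf).1.smul continuous_id.aestronglyMeasurable)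
    (ae_of_all _ fun q => ?_)
  rw [norm_smul, norm_div, Real.norm_eq_abs (q0 q), abs_of_pos (q0_pos q), div_mul_eq_mul_div,
    div_le_iff₀ (q0_pos q)]
  exact mul_le_mul_of_nonneg_left (norm_le_q0 q) (norm_nonneg _)

lemma inner_integral_div_q0_smul {f : E3 → ℝ} (hf : Integrable f) (v : E3) :
    ⟪v, ∫ q, (f q / q0 q) • q⟫_ℝ = ∫ q, ⟪v, q⟫_ℝ * f q / q0 q := by
  rw [← integral_inner (integrable_div_q0_smul hf)]
  congr 1 with q
  rw [real_inner_smul_right]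
  ring

lemma integral_div_q0_smul_apply {f : E3 → ℝ} (hf : Integrable f) (i : Fin 3) :
    (∫ q, (f q / q0 q) • q) i = ∫ q : E3, q i * f q / q0 q := by
  simpa only [EuclideanSpace.inner_single_left, map_one, one_mul] using
    inner_integral_div_q0_smul hf (EuclideanSpace.single i 1)

lemma integral_div_q0_pos {f : E3 → ℝ} (hf : Integrable f) (hnonneg : ∀ q, 0 ≤ f q)
    (hne : ¬ f =ᵐ[volume] 0) : 0 < ∫ q, f q / q0 q := by
  have h0 : 0 ≤ fun q => f q / q0 q := fun q => div_nonneg (hnonneg q) (q0_pos q).le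
  refine (integral_nonneg h0).lt_of_ne' fun h => hne ?_
  filter_upwards [(integral_eq_zero_iff_of_nonneg h0 (integrable_div_q0 hf)).1 h] with q hq
  exact (div_eq_zero_iff.1 hq).resolve_right (q0_pos q).ne'

lemma sqrt_moments_lt_integral {f : E3 → ℝ} (hf : Integrable f) (hnonneg : ∀ q, 0 ≤ f q)
    (hne : ¬ f =ᵐ[volume] 0) :
    √((∫ q, f q / q0 q) ^ 2 + ‖∫ q, (f q / q0 q) • q‖ ^ 2) < ∫ q, f q := by
  have hA := integral_div_q0_pos hf hnonneg hne
  have iB := (integrable_div_q0_smul hf).const_inner (𝕜 := ℝ) (∫ q, (f q / q0 q) • q)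
  set A := ∫ q, f q / q0 q with hAdef
  set B := ∫ q, (f q / q0 q) • q
  set R := √(A ^ 2 + ‖B‖ ^ 2) with hR
  have hRpos : 0 < R := Real.sqrt_pos.2 (by positivity)
  have hR2 : R ^ 2 = A ^ 2 + ‖B‖ ^ 2 := Real.sq_sqrt (by positivity)
  set h : E3 → ℝ := fun q => R * f q - (A * (f q / q0 q) + ⟪B, (f q / q0 q) • q⟫_ℝ) with hh
  have hfac (q : E3) : h q = (R * q0 q - (A + ⟪B, q⟫_ℝ)) * (f q / q0 q) := by
    have := (q0_pos q).ne'
    simp only [hh, real_inner_smul_right]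
    field_simp
  have h0 : 0 ≤ h := fun q => by
    rw [Pi.zero_apply, hfac]
    exact mul_nonneg (sub_nonneg.2 (add_inner_le A B q)) (div_nonneg (hnonneg q) (q0_pos q).le)
  have iA := (integrable_div_q0 hf).const_mul A
  have hint : Integrable h := (hf.const_mul R).sub (iA.add iB)
  have hval : ∫ q, h q = R * (∫ q, f q) - R ^ 2 := by
    refine (integral_sub (hf.const_mul R) (iA.add iB)).trans ?_
    refine congrArg₂ _ (integral_const_mul _ _) ((integral_add iA iB).trans ?_)
    rw [integral_const_mul, integral_inner (integrable_div_q0_smul hf), hR2,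
      ← real_inner_self_eq_norm_sq, ← hAdef]
    ring
  have hpos : 0 < ∫ q, h q := by
    refine (integral_nonneg h0).lt_of_ne' fun hz => hne ?_
    have hpt : ∀ᵐ q : E3, q ≠ A⁻¹ • B := compl_mem_ae_iff.2 (measure_singleton _)
    filter_upwards [(integral_eq_zero_iff_of_nonneg h0 hint).1 hz, hpt] with q hq hqne
    rw [hfac, Pi.zero_apply] at hq
    rcases mul_eq_zero.1 hq with hq | hq
    · refine absurd ?_ hqne
      rw [← smul_eq_of_add_inner_eq (sub_eq_zero.1 hq).symm, smul_smul, inv_mul_cancel₀ hA.ne',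
        one_smul]
    · exact (div_eq_zero_iff.1 hq).resolve_right (q0_pos q).ne'
  rw [hval] at hpos
  exact lt_of_mul_lt_mul_left (by linarith) hRpos.le

end Juttner

/-- for any measurable nonnegative `f`, not a.e. zero, with
`∫ (1+|q|) f(q) dq < ∞`, there exist unique `n > 0`, `β > 0`, `u ∈ ℝ³` such that
the Jüttner distribution `J(n,β,u;·)` has the same five moments as `f`. -/
theorem juttner_moments_exists_unique (f : E3 → ℝ)
    (hmeas : Measurable f) (hnonneg : ∀ q, 0 ≤ f q)
    (hne : ¬ f =ᵐ[(volume : Measure E3)] 0)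
    (hint : Integrable (fun q => (1 + ‖q‖) * f q)) :
    ∃! nβu : ℝ × ℝ × E3,
      0 < nβu.1 ∧ 0 < nβu.2.1 ∧
      (∫ q : E3, Jut nβu.1 nβu.2.1 nβu.2.2 q / q0 q) = (∫ q : E3, f q / q0 q) ∧
      (∫ q : E3, Jut nβu.1 nβu.2.1 nβu.2.2 q) = (∫ q : E3, f q) ∧
      (∀ i : Fin 3,
        (∫ q : E3, q i * Jut nβu.1 nβu.2.1 nβu.2.2 q / q0 q) =
          (∫ q : E3, q i * f q / q0 q)) := by
  have hf : Integrable f := by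
    refine hint.mono' hmeas.aestronglyMeasurable (ae_of_all _ fun q => ?_)
    rw [Real.norm_eq_abs, abs_of_nonneg (hnonneg q)]
    exact le_mul_of_one_le_left (hnonneg q) (by linarith [norm_nonneg q])
  have hA := integral_div_q0_pos hf hnonneg hne
  have hlt := sqrt_moments_lt_integral hf hnonneg hne
  have hBi := integral_div_q0_smul_apply hf
  set A := ∫ q, f q / q0 q
  set B := ∫ q, (f q / q0 q) • q
  set N := ∫ q, f q
  have hN : 0 < N := (Real.sqrt_nonneg _).trans_lt hlt
  have hlt2 : A ^ 2 + ‖B‖ ^ 2 < N ^ 2 := (Real.sqrt_lt' hN).1 hlt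
  have hd : 0 < N ^ 2 - ‖B‖ ^ 2 := by linarith [pow_pos hA 2]
  set n := √(N ^ 2 - ‖B‖ ^ 2) with hn
  have hnpos : 0 < n := Real.sqrt_pos.2 hd
  have hn2 : n ^ 2 = N ^ 2 - ‖B‖ ^ 2 := Real.sq_sqrt hd.le
  have hAn : A < n := Real.lt_sqrt_of_sq_lt (by linarith)
  obtain ⟨β, hβ, hβA⟩ := exists_massRatio_eq (div_pos hA hnpos) ((div_lt_one hnpos).2 hAn)
  refine ⟨(n, β, n⁻¹ • B), ⟨hnpos, hβ, ?_, ?_, fun i => ?_⟩, ?_⟩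
  · rw [integral_Jut_div_q0 n hβ, hβA, mul_div_cancel₀ _ hnpos.ne']
  · have h1 : 1 + ‖n⁻¹ • B‖ ^ 2 = (N / n) ^ 2 := by
      rw [norm_smul, norm_inv, Real.norm_eq_abs, abs_of_pos hnpos]
      field_simp
      linarith
    rw [integral_Jut n hβ, h1, Real.sqrt_sq (by positivity), mul_div_cancel₀ _ hnpos.ne']
  · rw [integral_apply_mul_Jut_div_q0 n hβ, ← hBi, PiLp.smul_apply, smul_eq_mul,
      mul_inv_cancel_left₀ hnpos.ne']
  · rintro ⟨m, γ, u⟩ ⟨hm, hγ, h1, h2, h3⟩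
    simp only at hm hγ h1 h2 h3
    rw [integral_Jut_div_q0 m hγ] at h1
    rw [integral_Jut m hγ] at h2
    have hu : m • u = B := by
      ext i
      rw [PiLp.smul_apply, smul_eq_mul, hBi, ← h3, integral_apply_mul_Jut_div_q0 m hγ]
    have hmn : m = n := by
      rw [hn, ← h2, ← hu, mul_pow, Real.sq_sqrt (by positivity), norm_smul, mul_pow,
        Real.norm_eq_abs, sq_abs, ← mul_sub, add_sub_cancel_right, mul_one, Real.sqrt_sq hm.le]
    subst hmn
    have hγβ : γ = β := massRatio_injOn hγ hβ (by rw [hβA, ← h1, mul_div_cancel_left₀ _ hm.ne'])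
    rw [hγβ, ← hu, smul_smul, inv_mul_cancel₀ hm.ne', one_smul]
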